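/- arXiv:1912.09580 — 3 statements merged into one kernel-verified Lean document; each statement's English description precedes it below -/
import Mathlib

section
/- (Hairy ball theorem on S², used implicitly since the Euler characteristic of the sphere is 2.) Let v : ℝ³ → ℝ³ be continuous on the unit sphere S² = {x : ‖x‖ = 1} and tangent to it, i.e. ⟨v(x), x⟩ = 0 for every x with ‖x‖ = 1. Then v has a singularity on the sphere: there exists x with ‖x‖ = 1 and v(x) = 0. In particular every continuous tangent vector field on the sphere has at least one singularity. -/
open scoped RealInnerProductSpace

/-- Two continuous logarithms of the same function on a preconnected space that agree at a point
are equal. -/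
theorem Complex.eq_of_exp_comp_eq {X : Type*} [TopologicalSpace X] [PreconnectedSpace X]
    {f g : X → ℂ} (hf : Continuous f) (hg : Continuous g)
    (h : ∀ x, Complex.exp (f x) = Complex.exp (g x)) (a : X) (ha : f a = g a) : f = g :=
  Complex.isCoveringMap_exp.eq_of_comp_eq hf hg (funext fun x => Subtype.ext (h x)) a ha

/-- A nowhere vanishing continuous function on a simply connected, locally path connected space
has a continuous logarithm. -/
theorem Complex.exists_continuous_exp_eq {X : Type*} [TopologicalSpace X] [SimplyConnectedSpace X]
    [LocallyPathConnectedSpace X] {g : X → ℂ} (hg : Continuous g) (h0 : ∀ x, g x ≠ 0) (a : X) :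
    ∃ f : X → ℂ, Continuous f ∧ ∀ x, Complex.exp (f x) = g x := by
  obtain ⟨F, ⟨-, hF⟩, -⟩ := Complex.isCoveringMapOn_exp.existsUnique_continuousMap_lifts
    ⟨g, hg⟩ (a₀ := a) (Complex.exp_log (h0 a)) h0
  exact ⟨F, F.continuous, fun x => congrFun hF x⟩

/-- The winding number of a homotopy of loops in `ℂ \ {0}` cannot change from `-1` to `1`. -/
theorem Complex.not_winding_neg_one_to_one {g : ℝ × ℝ → ℂ} (hg : Continuous g) (h0 : ∀ p, g p ≠ 0)
    (hper : ∀ s, g (s, 2 * Real.pi) = g (s, 0)) {a b : ℝ}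
    (ha : ∀ t : ℝ, g (a, t) = g (a, 0) * Complex.exp (-(t * Complex.I)))
    (hb : ∀ t : ℝ, g (b, t) = g (b, 0) * Complex.exp (t * Complex.I)) : False := by
  obtain ⟨h, hc, he⟩ := Complex.exists_continuous_exp_eq hg h0 (0, 0)
  have ea : (fun t : ℝ => h (a, t)) = fun t : ℝ => h (a, 0) + -(t * Complex.I) :=
    Complex.eq_of_exp_comp_eq (by fun_prop) (by fun_prop)
      (fun t => by rw [Complex.exp_add, he, he, ha]) 0 (by simp)
  have eb : (fun t : ℝ => h (b, t)) = fun t : ℝ => h (b, 0) + t * Complex.I :=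
    Complex.eq_of_exp_comp_eq (by fun_prop) (by fun_prop)
      (fun t => by rw [Complex.exp_add, he, he, hb]) 0 (by simp)
  have ed : (fun s : ℝ => h (s, 2 * Real.pi)) =
      fun s : ℝ => h (s, 0) + (h (a, 2 * Real.pi) - h (a, 0)) :=
    Complex.eq_of_exp_comp_eq (by fun_prop) (by fun_prop)
      (fun s => by rw [Complex.exp_add, Complex.exp_sub, he, he, he, he, hper, hper,
        div_self (h0 _), mul_one]) a (by ring)
  have e1 := congrFun ea (2 * Real.pi)
  have e2 := congrFun eb (2 * Real.pi)
  have e3 := congrFun ed b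
  have e4 : ((2 * Real.pi : ℝ) : ℂ) * Complex.I = 0 := by
    linear_combination (1 / 2) * (e3 - e2 + e1)
  simp [Real.pi_ne_zero] at e4

/-- Hairy ball theorem on `S²`: every continuous tangent vector field on the unit sphere in
`ℝ³` vanishes somewhere. -/
theorem hairy_ball_sphere
    (v : EuclideanSpace ℝ (Fin 3) → EuclideanSpace ℝ (Fin 3))
    (hcont : ContinuousOn v {x : EuclideanSpace ℝ (Fin 3) | ‖x‖ = 1})
    (htang : ∀ x : EuclideanSpace ℝ (Fin 3), ‖x‖ = 1 → ⟪v x, x⟫ = 0) :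
    ∃ x : EuclideanSpace ℝ (Fin 3), ‖x‖ = 1 ∧ v x = 0 := by
  by_contra! hv
  let p : ℝ × ℝ → EuclideanSpace ℝ (Fin 3) := fun q =>
    !₂[Real.sin q.1 * Real.cos q.2, Real.sin q.1 * Real.sin q.2, Real.cos q.1]
  have hp : ∀ q, ‖p q‖ = 1 := fun q => by
    rw [EuclideanSpace.norm_eq, Real.sqrt_eq_one]
    simp only [p, Fin.sum_univ_three, Real.norm_eq_abs, sq_abs]
    simp only [Matrix.cons_val]
    linear_combination Real.sin q.1 ^ 2 * Real.sin_sq_add_cos_sq q.2 + Real.sin_sq_add_cos_sq q.1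
  have hpc : Continuous p := by
    refine (PiLp.continuous_toLp 2 _).comp (continuous_pi fun i => ?_)
    fin_cases i <;> simp <;> fun_prop
  have hw : Continuous fun q => v (p q) := hcont.comp_continuous hpc hp
  have hwi : ∀ i, Continuous fun q => v (p q) i := fun i =>
    (EuclideanSpace.proj (𝕜 := ℝ) i).continuous.comp hw
  -- the coordinates of `v` in the moving frame given by the spherical coordinates `p`
  let A : ℝ × ℝ → ℝ := fun q => v (p q) 0 * (Real.cos q.1 * Real.cos q.2)
    + v (p q) 1 * (Real.cos q.1 * Real.sin q.2) - v (p q) 2 * Real.sin q.1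
  let B : ℝ × ℝ → ℝ := fun q => -(v (p q) 0 * Real.sin q.2) + v (p q) 1 * Real.cos q.2
  have hA : Continuous A :=
    (((hwi 0).mul (by fun_prop)).add ((hwi 1).mul (by fun_prop))).sub ((hwi 2).mul (by fun_prop))
  have hB : Continuous B :=
    ((hwi 0).mul (by fun_prop)).neg.add ((hwi 1).mul (by fun_prop))
  have hnorth : ∀ t, p (0, t) = p (0, 0) := fun t => by simp [p]
  have hsouth : ∀ t, p (Real.pi, t) = p (Real.pi, 0) := fun t => by simp [p]
  refine Complex.not_winding_neg_one_to_one (g := fun q => (A q : ℂ) + B q * Complex.I)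
    (a := 0) (b := Real.pi) (by fun_prop) (fun q hq => ?_) (fun s => ?_) (fun t => ?_) fun t => ?_
  · have hA0 : A q = 0 := by simpa using congrArg Complex.re hq
    have hB0 : B q = 0 := by simpa using congrArg Complex.im hq
    have hN := htang (p q) (hp q)
    simp only [PiLp.inner_apply, Fin.sum_univ_three, RCLike.inner_apply, conj_trivial] at hN
    have hN' : Real.sin q.1 * Real.cos q.2 * v (p q) 0 + Real.sin q.1 * Real.sin q.2 * v (p q) 1
      + Real.cos q.1 * v (p q) 2 = 0 := hN
    simp only [A] at hA0
    simp only [B] at hB0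
    have h1 := Real.sin_sq_add_cos_sq q.1
    have h2 := Real.sin_sq_add_cos_sq q.2
    refine hv (p q) (hp q) ?_
    ext i
    fin_cases i
    · change v (p q) 0 = 0
      linear_combination Real.sin q.1 * Real.cos q.2 * hN' + Real.cos q.1 * Real.cos q.2 * hA0
        - Real.sin q.2 * hB0 - (v (p q) 0 * Real.cos q.2 ^ 2
          + v (p q) 1 * Real.sin q.2 * Real.cos q.2) * h1 - v (p q) 0 * h2
    · change v (p q) 1 = 0
      linear_combination Real.sin q.1 * Real.sin q.2 * hN' + Real.cos q.1 * Real.sin q.2 * hA0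
        + Real.cos q.2 * hB0 - (v (p q) 0 * Real.cos q.2 * Real.sin q.2
          + v (p q) 1 * Real.sin q.2 ^ 2) * h1 - v (p q) 1 * h2
    · change v (p q) 2 = 0
      linear_combination Real.cos q.1 * hN' - Real.sin q.1 * hA0 - v (p q) 2 * h1
  · have : p (s, 2 * Real.pi) = p (s, 0) := by simp [p]
    simp [A, B, this]
  · rw [← neg_mul, ← Complex.ofReal_neg, Complex.exp_mul_I, ← Complex.ofReal_cos,
      ← Complex.ofReal_sin]
    apply Complex.ext <;> simp [A, B, hnorth t]
  · rw [Complex.exp_mul_I, ← Complex.ofReal_cos, ← Complex.ofReal_sin]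
    apply Complex.ext <;> simp [A, B, hsouth t]
    ring
end

section
/- Let E be a finite-dimensional real inner product space, f : E → ℝ continuously differentiable (so x ↦ ∇f(x) is continuous), and γ : ℝ → E a gradient trajectory of f (γ'(t) = ∇f(γ(t)) for all t) whose image is contained in a compact set K. Then every ω-limit point of γ is a singularity of the gradient field: if q ∈ E and there is a sequence tₙ → ∞ with γ(tₙ) → q, then ∇f(q) = 0. (The ω-limit set of a gradient trajectory consists of singular points, as required in the definition of a Morse vector field.) -/
open Filter

/-- Along a gradient trajectory, `f` has derivative the squared norm of the gradient. -/
theorem hasDerivAt_comp_gradient_trajectory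
    {E : Type*} [NormedAddCommGroup E] [InnerProductSpace ℝ E] [CompleteSpace E]
    {f : E → ℝ} {γ : ℝ → E} {t : ℝ} (hf : DifferentiableAt ℝ f (γ t))
    (hγ : HasDerivAt γ (gradient f (γ t)) t) :
    HasDerivAt (fun s ↦ f (γ s)) (‖gradient f (γ t)‖ ^ 2) t := by
  have h := hf.hasGradientAt.hasFDerivAt.comp_hasDerivAt t hγ
  rwa [InnerProductSpace.toDual_apply_apply, real_inner_self_eq_norm_sq] at h

/-- Every ω-limit point of a precompact gradient trajectory is a singularity of the
gradient field. -/
theorem omega_limit_point_is_singularity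
    {E : Type*} [NormedAddCommGroup E] [InnerProductSpace ℝ E] [FiniteDimensional ℝ E]
    {f : E → ℝ} (hf : Differentiable ℝ f) (hgrad : Continuous fun x ↦ gradient f x)
    {γ : ℝ → E} (hγ : ∀ t : ℝ, HasDerivAt γ (gradient f (γ t)) t)
    {K : Set E} (hK : IsCompact K) (hrange : Set.range γ ⊆ K)
    {q : E}
    (hq : ∃ t : ℕ → ℝ, Tendsto t atTop atTop ∧ Tendsto (fun n ↦ γ (t n)) atTop (nhds q)) :
    gradient f q = 0 := by
  obtain ⟨t, ht, htq⟩ := hq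
  have hg : ∀ s, HasDerivAt (fun s ↦ f (γ s)) (‖gradient f (γ s)‖ ^ 2) s := fun s ↦
    hasDerivAt_comp_gradient_trajectory (hf _) (hγ s)
  have hmono : Monotone fun s ↦ f (γ s) :=
    monotone_of_hasDerivAt_nonneg hg fun s ↦ sq_nonneg _
  have hlim : Tendsto (fun n ↦ f (γ (t n))) atTop (nhds (f q)) :=
    (hf.continuous.tendsto q).comp htq
  have hle : ∀ s, f (γ s) ≤ f q := fun s ↦
    ge_of_tendsto hlim ((ht.eventually_ge_atTop s).mono fun n hn ↦ hmono hn)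
  obtain ⟨C, hC⟩ := hK.exists_bound_of_continuousOn hgrad.continuousOn
  have hCγ : ∀ s, ‖gradient f (γ s)‖ ≤ C := fun s ↦ hC _ (hrange ⟨s, rfl⟩)
  have hlip : ∀ a b, ‖γ b - γ a‖ ≤ C * ‖b - a‖ := fun a b ↦
    convex_univ.norm_image_sub_le_of_norm_hasDerivWithin_le
      (fun s _ ↦ (hγ s).hasDerivWithinAt) (fun s _ ↦ hCγ s) (Set.mem_univ a) (Set.mem_univ b)
  by_contra hne
  have ha : 0 < ‖gradient f q‖ := norm_pos_iff.2 hne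
  set a := ‖gradient f q‖
  obtain ⟨r, hr, hball⟩ := Metric.eventually_nhds_iff.1
    ((hgrad.norm.tendsto q).eventually_const_lt (half_lt_self ha))
  have hC0 : 0 ≤ C := (norm_nonneg _).trans (hCγ 0)
  have hC1 : 0 < C + 1 := by linarith
  set δ := r / 2 / (C + 1) with hδ_def
  have hδ : 0 < δ := by positivity
  have hCδ : (C + 1) * δ = r / 2 := by rw [hδ_def]; field_simp
  have hgain : 0 < δ * (a / 2) ^ 2 := by positivity
  obtain ⟨n, hn, hn'⟩ := ((Metric.tendsto_nhds.1 htq (r / 2) (half_pos hr)).and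
    (hlim.eventually_const_lt (sub_lt_self (f q) hgain))).exists
  obtain ⟨c, ⟨hc1, hc2⟩, hc⟩ := exists_hasDerivAt_eq_slope (fun s ↦ f (γ s))
    (fun s ↦ ‖gradient f (γ s)‖ ^ 2) (lt_add_of_pos_right (t n) hδ)
    (fun s _ ↦ (hg s).continuousAt.continuousWithinAt) (fun s _ ↦ hg s)
  have hcn : dist (γ c) (γ (t n)) ≤ r / 2 := by
    rw [dist_eq_norm]
    have h := hlip (t n) c
    rw [Real.norm_of_nonneg (by linarith)] at h
    nlinarith
  have hfast : a / 2 < ‖gradient f (γ c)‖ :=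
    hball (by linarith [dist_triangle (γ c) (γ (t n)) q])
  have hsq : (a / 2) ^ 2 < ‖gradient f (γ c)‖ ^ 2 := by gcongr
  rw [add_sub_cancel_left, eq_div_iff hδ.ne'] at hc
  nlinarith [hle (t n + δ), mul_lt_mul_of_pos_left hsq hδ]
end

section
/- Let E be a finite-dimensional real inner product space, f : E → ℝ continuously differentiable, and γ : ℝ → E a gradient trajectory of f (γ'(t) = ∇f(γ(t)) for all t) whose image is contained in a compact set K. Then f is constant on the set of ω-limit points of γ: if q₁ and q₂ are both limits of γ along sequences of times tending to +∞, then f(q₁) = f(q₂). -/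
open Filter

/-- A differentiable function is nondecreasing along its gradient trajectories. -/
theorem monotone_comp_of_hasDerivAt_gradient
    {E : Type*} [NormedAddCommGroup E] [InnerProductSpace ℝ E] [CompleteSpace E]
    {f : E → ℝ} (hf : Differentiable ℝ f)
    {γ : ℝ → E} (hγ : ∀ t : ℝ, HasDerivAt γ (gradient f (γ t)) t) :
    Monotone fun t ↦ f (γ t) := by
  refine monotone_of_hasDerivAt_nonneg (f' := fun t ↦ inner ℝ (gradient f (γ t)) (gradient f (γ t)))
    (fun t ↦ ?_) fun t ↦ real_inner_self_nonneg
  exact (hf (γ t)).hasGradientAt.hasFDerivAt.comp_hasDerivAt t (hγ t)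

/-- Along a gradient trajectory, the values of `f` are bounded above by its value at any
ω-limit point. -/
theorem le_of_tendsto_gradient_trajectory
    {E : Type*} [NormedAddCommGroup E] [InnerProductSpace ℝ E] [CompleteSpace E]
    {f : E → ℝ} (hf : Differentiable ℝ f)
    {γ : ℝ → E} (hγ : ∀ t : ℝ, HasDerivAt γ (gradient f (γ t)) t)
    {q : E} {t : ℕ → ℝ} (ht : Tendsto t atTop atTop)
    (hq : Tendsto (fun n ↦ γ (t n)) atTop (nhds q)) (s : ℝ) :
    f (γ s) ≤ f q :=
  ge_of_tendsto ((hf.continuous.tendsto q).comp hq) <|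
    (ht.eventually_ge_atTop s).mono fun _ hn ↦ monotone_comp_of_hasDerivAt_gradient hf hγ hn

/-- `f` is constant on the set of ω-limit points of a precompact gradient trajectory. -/
theorem eq_on_omega_limit_points
    {E : Type*} [NormedAddCommGroup E] [InnerProductSpace ℝ E] [FiniteDimensional ℝ E]
    {f : E → ℝ} (hf : Differentiable ℝ f) (hgrad : Continuous fun x ↦ gradient f x)
    {γ : ℝ → E} (hγ : ∀ t : ℝ, HasDerivAt γ (gradient f (γ t)) t)
    {K : Set E} (hK : IsCompact K) (hrange : Set.range γ ⊆ K)
    {q₁ q₂ : E}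
    (hq₁ : ∃ t : ℕ → ℝ, Tendsto t atTop atTop ∧ Tendsto (fun n ↦ γ (t n)) atTop (nhds q₁))
    (hq₂ : ∃ t : ℕ → ℝ, Tendsto t atTop atTop ∧ Tendsto (fun n ↦ γ (t n)) atTop (nhds q₂)) :
    f q₁ = f q₂ := by
  obtain ⟨t₁, ht₁, hlim₁⟩ := hq₁
  obtain ⟨t₂, ht₂, hlim₂⟩ := hq₂
  exact le_antisymm
    (le_of_tendsto' ((hf.continuous.tendsto q₁).comp hlim₁) fun n ↦
      le_of_tendsto_gradient_trajectory hf hγ ht₂ hlim₂ (t₁ n))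
    (le_of_tendsto' ((hf.continuous.tendsto q₂).comp hlim₂) fun n ↦
      le_of_tendsto_gradient_trajectory hf hγ ht₁ hlim₁ (t₂ n))
end
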